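/- The variance of the Naive Bayes estimator with correlation factor, viewed as a function of t, attains its minimum over t > 0 at t* = (1−p_i)·A/(B − A): for every t > 0, V(t) ≥ V(t*), where V(t) = (p_i·(1+2t)·A + t²·B)/(m·N·(p_i + t)²), assuming B > A and p_i < 1. -/

import Mathlib

open Finset

/-- A quadratic over `(q + t)²` whose derivative vanishes at `s ≥ 0` is minimized there. -/
theorem correlation_ratio_le {q A B s t : ℝ} (hq : 0 < q) (hAB : A ≤ B) (hs : 0 ≤ s) (ht : 0 ≤ t)
    (hcrit : s * (B - A) = (1 - q) * A) :
    (q * (1 + 2 * s) * A + s ^ 2 * B) / (q + s) ^ 2 ≤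
      (q * (1 + 2 * t) * A + t ^ 2 * B) / (q + t) ^ 2 := by
  have key : (q * (1 + 2 * t) * A + t ^ 2 * B) * (q + s) ^ 2 -
      (q * (1 + 2 * s) * A + s ^ 2 * B) * (q + t) ^ 2 =
      q * (B - A) * (q + s) * (t - s) ^ 2 := by
    linear_combination (q * (t - s) * (2 * q + s + t)) * hcrit
  have hnonneg : 0 ≤ q * (B - A) * (q + s) * (t - s) ^ 2 := by
    have := sub_nonneg.2 hAB
    positivity
  rw [div_le_div_iff₀ (by positivity) (by positivity)]
  linarith

/-- The variance `V(t) = (p i·(1+2t)·A + t²·B)/(m·N·(p i + t)²)` of the Naive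
Bayes estimator with correlation factor `t`, with `A = θ i·(1−θ i)` and
`B = ∑ l, p l·θ l·(1−θ l)`, attains its minimum over `t > 0` at
`t* = (1−p i)·A/(B − A)`, assuming `B > A` and `p i < 1`. -/
theorem nb_correlation_variance_min
    (m k : ℕ) (hm : 1 ≤ m) (hk : 1 ≤ k)
    (n : Fin k → ℕ) (hn : ∀ l, 1 ≤ n l)
    (N : ℕ) (hN : N = ∑ l, n l)
    (θ : Fin k → ℝ) (hθ0 : ∀ l, 0 ≤ θ l) (hθ1 : ∀ l, θ l ≤ 1)
    (i : Fin k)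
    (p : Fin k → ℝ) (hp : ∀ l, p l = (n l : ℝ) / N) (hpi : p i < 1)
    (A B : ℝ) (hA : A = θ i * (1 - θ i)) (hB : B = ∑ l, p l * (θ l * (1 - θ l)))
    (hBA : A < B)
    (V : ℝ → ℝ)
    (hV : ∀ t : ℝ,
      V t = (p i * (1 + 2 * t) * A + t ^ 2 * B) / (m * N * (p i + t) ^ 2))
    (tstar : ℝ) (htstar : tstar = (1 - p i) * A / (B - A)) :
    ∀ t : ℝ, 0 < t → V tstar ≤ V t := by
  intro t ht
  have hle : n i ≤ N := hN ▸ single_le_sum (fun l _ => Nat.zero_le (n l)) (mem_univ i)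
  have hni : (0 : ℝ) < n i := by exact_mod_cast hn i
  have hNpos : (0 : ℝ) < N := by exact_mod_cast (hn i).trans hle
  have hq : 0 < p i := hp i ▸ div_pos hni hNpos
  have hA0 : 0 ≤ A := hA ▸ mul_nonneg (hθ0 i) (sub_nonneg.2 (hθ1 i))
  have hD : 0 < B - A := sub_pos.2 hBA
  have hs : 0 ≤ tstar := htstar ▸ div_nonneg (mul_nonneg (sub_nonneg.2 hpi.le) hA0) hD.le
  have hcrit : tstar * (B - A) = (1 - p i) * A := by
    rw [htstar, div_mul_cancel₀ _ hD.ne']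
  simp only [hV, div_mul_eq_div_div_swap _ (m * N : ℝ)]
  exact div_le_div_of_nonneg_right (correlation_ratio_le hq hBA.le hs ht.le hcrit) (by positivity)
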